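/- Let f : ℝ^p → ℝ be differentiable, L-smooth and m-strongly convex with 0 < m ≤ L, let x⋆ be the unique point with ∇f(x⋆) = 0, let α, β ∈ ℝ and 0 ≤ ρ < 1. Let X̃₁ = (1/2)[[β²m, −β²m, −β], [−β²m, β²m, β], [−β, β, α(2−Lα)]], X̃₂ = (1/2)[[(1+β)²m, −β(1+β)m, −(1+β)], [−β(1+β)m, β²m, β], [−(1+β), β, α(2−Lα)]], X̃ = ρ²X̃₁ + (1−ρ²)X̃₂, Ã = [[1+β, −β], [1, 0]] and B̃ = [[−α], [0]]. Suppose there is a positive semidefinite 2×2 real matrix P̃ such that [[ÃᵀP̃Ã − ρ²P̃, ÃᵀP̃B̃], [B̃ᵀP̃Ã, B̃ᵀP̃B̃]] − X̃ is negative semidefinite. Consider Nesterov's accelerated method x_{k+1} = y_k − α∇f(y_k), y_k = (1+β)x_k − βx_{k−1}, and define 𝒱_k := P̃₁₁‖x_k − x⋆‖² + 2P̃₁₂⟨x_k − x⋆, x_{k−1} − x⋆⟩ + P̃₂₂‖x_{k−1} − x⋆‖² + f(x_k) − f(x⋆). Then 𝒱_{k+1} ≤ ρ²𝒱_k for all k,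 and consequently f(x_k) − f(x⋆) ≤ ρ^{2k}·𝒱₀ for all k. -/

import Mathlib

open Matrix RealInnerProductSpace

/-- Descent lemma: a differentiable function with `L`-Lipschitz gradient lies below its quadratic
upper model. -/
theorem le_add_inner_gradient_add_sq {E : Type*} [NormedAddCommGroup E] [InnerProductSpace ℝ E]
    [CompleteSpace E] {f : E → ℝ} {L : ℝ} (hf : Differentiable ℝ f)
    (hL : ∀ x y, ‖gradient f x - gradient f y‖ ≤ L * ‖x - y‖) (x d : E) :
    f (x + d) ≤ f x + ⟪gradient f x, d⟫ + L / 2 * ‖d‖ ^ 2 := by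
  let φ : ℝ → ℝ := fun t ↦ f (x + t • d) - t * ⟪gradient f x, d⟫ - L / 2 * ‖d‖ ^ 2 * t ^ 2
  have hφ (t : ℝ) : HasDerivAt φ (⟪gradient f (x + t • d), d⟫ - ⟪gradient f x, d⟫
      - L * ‖d‖ ^ 2 * t) t := by
    have hline : HasDerivAt (fun t : ℝ ↦ x + t • d) d t := by
      simpa using ((hasDerivAt_id t).smul_const d).const_add x
    have hcomp := (hf (x + t • d)).hasGradientAt.hasFDerivAt.comp_hasDerivAt t hline
    rw [InnerProductSpace.toDual_apply_apply] at hcomp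
    refine ((hcomp.sub ((hasDerivAt_id t).mul_const ⟪gradient f x, d⟫)).sub
      ((hasDerivAt_pow 2 t).const_mul (L / 2 * ‖d‖ ^ 2))).congr_deriv ?_
    norm_num
    ring
  have hanti : AntitoneOn φ (Set.Icc 0 1) := by
    refine antitoneOn_of_deriv_nonpos (convex_Icc 0 1)
      (fun t _ ↦ (hφ t).continuousAt.continuousWithinAt)
      (fun t _ ↦ (hφ t).differentiableAt.differentiableWithinAt) fun t ht ↦ ?_
    rw [interior_Icc] at ht
    rw [(hφ t).deriv, ← inner_sub_left]
    have hgrad := hL (x + t • d) x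
    rw [add_sub_cancel_left, norm_smul, Real.norm_of_nonneg ht.1.le] at hgrad
    have hcs := real_inner_le_norm (gradient f (x + t • d) - gradient f x) d
    nlinarith [mul_le_mul_of_nonneg_right hgrad (norm_nonneg d)]
  have h := hanti (Set.left_mem_Icc.2 zero_le_one) (Set.right_mem_Icc.2 zero_le_one) zero_le_one
  simp only [φ, one_smul, zero_smul, add_zero] at h
  linarith

/-- A quadratic form that is nonpositive on scalars is nonpositive on tuples of Euclidean vectors,
with products replaced by inner products. -/
theorem sum_sum_mul_inner_nonpos {ι κ : Type*} [Fintype ι] [Fintype κ] {M : Matrix ι ι ℝ}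
    (hM : ∀ v : ι → ℝ, v ⬝ᵥ M.mulVec v ≤ 0) (z : ι → EuclideanSpace ℝ κ) :
    ∑ i, ∑ j, M i j * ⟪z i, z j⟫ ≤ 0 := by
  have h : ∑ i, ∑ j, M i j * ⟪z i, z j⟫ = ∑ c, (fun i ↦ z i c) ⬝ᵥ M.mulVec (fun i ↦ z i c) := by
    simp only [dotProduct, mulVec, PiLp.inner_apply, Finset.mul_sum]
    conv_rhs => rw [Finset.sum_comm]
    refine Finset.sum_congr rfl fun i _ ↦ ?_
    conv_rhs => rw [Finset.sum_comm]
    refine Finset.sum_congr rfl fun j _ ↦ Finset.sum_congr rfl fun c _ ↦ ?_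
    simp only [RCLike.inner_apply, conj_trivial]
    ring
  exact h ▸ Finset.sum_nonpos fun c _ ↦ hM _

/-- Theorem 4 of the paper: if the dissipativity LMI for Nesterov's accelerated method is
feasible with `P̃ ⪰ 0`, then `𝒱_k` is a Lyapunov function certifying the linear rate `ρ²`. -/
theorem nesterov_lyapunov_from_LMI {p : ℕ} (f : EuclideanSpace ℝ (Fin p) → ℝ)
    (L m : ℝ) (hm : 0 < m) (hmL : m ≤ L)
    (hf : Differentiable ℝ f)
    (hsmooth : ∀ x y, ‖gradient f x - gradient f y‖ ≤ L * ‖x - y‖)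
    (hsc : ∀ x y, f x ≥ f y + ⟪gradient f y, x - y⟫ + m / 2 * ‖x - y‖ ^ 2)
    (xs : EuclideanSpace ℝ (Fin p)) (hxs : gradient f xs = 0)
    (α β ρ : ℝ) (hρ0 : 0 ≤ ρ) (hρ1 : ρ < 1)
    (X₁ X₂ Xt : Matrix (Fin 3) (Fin 3) ℝ)
    (hX1 : X₁ = (1 / 2 : ℝ) • !![β ^ 2 * m, -(β ^ 2 * m), -β;
        -(β ^ 2 * m), β ^ 2 * m, β;
        -β, β, α * (2 - L * α)])
    (hX2 : X₂ = (1 / 2 : ℝ) • !![(1 + β) ^ 2 * m, -(β * (1 + β) * m), -(1 + β);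
        -(β * (1 + β) * m), β ^ 2 * m, β;
        -(1 + β), β, α * (2 - L * α)])
    (hXt : Xt = ρ ^ 2 • X₁ + (1 - ρ ^ 2) • X₂)
    (At : Matrix (Fin 2) (Fin 2) ℝ) (hAt : At = !![1 + β, -β; 1, 0])
    (Bt : Matrix (Fin 2) (Fin 1) ℝ) (hBt : Bt = !![-α; 0])
    (Pt : Matrix (Fin 2) (Fin 2) ℝ) (hPsymm : Pt.IsSymm)
    (hPsd : ∀ v : Fin 2 → ℝ, 0 ≤ v ⬝ᵥ Pt.mulVec v)
    (hLMI : ∀ v : Fin 3 → ℝ,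
      v ⬝ᵥ ((!![(Atᵀ * Pt * At - ρ ^ 2 • Pt) 0 0, (Atᵀ * Pt * At - ρ ^ 2 • Pt) 0 1,
            (Atᵀ * Pt * Bt) 0 0;
          (Atᵀ * Pt * At - ρ ^ 2 • Pt) 1 0, (Atᵀ * Pt * At - ρ ^ 2 • Pt) 1 1,
            (Atᵀ * Pt * Bt) 1 0;
          (Btᵀ * Pt * At) 0 0, (Btᵀ * Pt * At) 0 1, (Btᵀ * Pt * Bt) 0 0] - Xt).mulVec v) ≤ 0)
    (x xm : ℕ → EuclideanSpace ℝ (Fin p))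
    (hxm : ∀ k, xm (k + 1) = x k)
    (hiter : ∀ k, x (k + 1) = ((1 + β) • x k - β • xm k)
        - α • gradient f ((1 + β) • x k - β • xm k))
    (V : ℕ → ℝ)
    (hV : ∀ k, V k = Pt 0 0 * ‖x k - xs‖ ^ 2 + 2 * Pt 0 1 * ⟪x k - xs, xm k - xs⟫
        + Pt 1 1 * ‖xm k - xs‖ ^ 2 + (f (x k) - f xs)) :
    (∀ k, V (k + 1) ≤ ρ ^ 2 * V k) ∧ ∀ k, f (x k) - f xs ≤ ρ ^ (2 * k) * V 0 := by
  have hP10 : Pt 1 0 = Pt 0 1 := hPsymm.apply 0 1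
  have hstep (k : ℕ) : V (k + 1) ≤ ρ ^ 2 * V k := by
    have hquad := sum_sum_mul_inner_nonpos hLMI
      ![x k - xs, xm k - xs, gradient f ((1 + β) • x k - β • xm k)]
    have hnext := hiter k
    set y := (1 + β) • x k - β • xm k with hy
    have hdescent := le_add_inner_gradient_add_sq hf hsmooth y (-(α • gradient f y))
    rw [← sub_eq_add_neg, ← hnext] at hdescent
    have hcur := hsc (x k) y
    have hopt := hsc xs y
    set g := gradient f y
    set u := x k - xs with hu
    set w := xm k - xs with hw
    have hcur_sub : x k - y = β • w - β • u := by rw [hy, hu, hw]; module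
    have hopt_sub : xs - y = β • w - (1 + β) • u := by rw [hy, hu, hw]; module
    have hnext_sub : x (k + 1) - xs = (1 + β) • u - β • w - α • g := by
      rw [hnext, hy, hu, hw]; module
    rw [hcur_sub] at hcur
    rw [hopt_sub] at hopt
    rw [hV, hV, hxm, hnext_sub, ← hu, ← hw]
    subst hAt hBt hX1 hX2 hXt
    have hgu : ⟪g, u⟫ = ⟪u, g⟫ := real_inner_comm _ _
    have hgw : ⟪g, w⟫ = ⟪w, g⟫ := real_inner_comm _ _
    have hwu : ⟪w, u⟫ = ⟪u, w⟫ := real_inner_comm _ _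
    simp [Fin.sum_univ_three, Matrix.mul_apply, Fin.sum_univ_two, hP10, hgu, hgw, hwu,
      -inner_self_eq_norm_sq_to_K] at hquad
    simp only [← real_inner_self_eq_norm_sq, inner_sub_left, inner_sub_right, inner_smul_left,
      inner_smul_right, inner_neg_left, inner_neg_right, conj_trivial, hgu, hgw, hwu]
      at hquad hdescent hcur hopt ⊢
    have hρ : 0 ≤ 1 - ρ ^ 2 := by nlinarith
    have hcur' := mul_le_mul_of_nonneg_left hcur (sq_nonneg ρ)
    have hopt' := mul_le_mul_of_nonneg_left hopt hρ
    linarith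
  refine ⟨hstep, fun k ↦ ?_⟩
  have hV_le : V k ≤ ρ ^ (2 * k) * V 0 := by
    induction k with
    | zero => simp
    | succ k ih =>
      calc V (k + 1) ≤ ρ ^ 2 * V k := hstep k
        _ ≤ ρ ^ 2 * (ρ ^ (2 * k) * V 0) := mul_le_mul_of_nonneg_left ih (sq_nonneg ρ)
        _ = ρ ^ (2 * (k + 1)) * V 0 := by ring
  have hquad := sum_sum_mul_inner_nonpos (M := -Pt)
    (fun v ↦ by simpa only [neg_mulVec, dotProduct_neg, neg_nonpos] using hPsd v) ![x k - xs, xm k - xs]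
  simp only [Fin.sum_univ_two, Matrix.neg_apply, cons_val_zero, cons_val_one, hP10,
    real_inner_self_eq_norm_sq, real_inner_comm (x k - xs) (xm k - xs)] at hquad
  have := hV k
  linarith
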